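/- Let w = w^J · w_J be a Billey–Postnikov decomposition in a Coxeter group W with supp(w^J) ∩ supp(w_J) = {s} for a single simple reflection s. Then the middle multiplication map φ(x) = x^J · s · x_J, defined on the interval [e,w] via parabolic decomposition x = x^J x_J, is an automorphism of the undirected Bruhat graph Γ(e,w): i.e., φ is a bijection of [e,w] to itself and x⁻¹y is a reflection iff φ(x)⁻¹φ(y) is a reflection. -/

import Mathlib

open CoxeterSystem

variable {B W : Type*} [Group W] {M : CoxeterMatrix B}

/-- One step of Bruhat order: multiply on the right by a reflection, increasing length. -/
def bruhatStep (cs : CoxeterSystem M W) (x y : W) : Prop :=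
  ∃ t : W, cs.IsReflection t ∧ y = x * t ∧ cs.length x < cs.length y

/-- Bruhat order on a Coxeter group. -/
def bruhatLE (cs : CoxeterSystem M W) : W → W → Prop :=
  Relation.ReflTransGen (bruhatStep cs)

/-- Strict Bruhat order. -/
def bruhatLT (cs : CoxeterSystem M W) (x y : W) : Prop :=
  bruhatLE cs x y ∧ x ≠ y

/-- Cover relation in Bruhat order. -/
def bruhatCovBy (cs : CoxeterSystem M W) (x y : W) : Prop :=
  bruhatLE cs x y ∧ cs.length y = cs.length x + 1

/-- The Bruhat interval `[u, v]`. -/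
def bruhatInterval (cs : CoxeterSystem M W) (u v : W) : Set W :=
  {x | bruhatLE cs u x ∧ bruhatLE cs x v}

/-- The support of `w`: simple reflections appearing in a reduced word for `w`. -/
def supp (cs : CoxeterSystem M W) (w : W) : Set B :=
  {i | ∃ ω : List B, cs.IsReduced ω ∧ w = cs.wordProd ω ∧ i ∈ ω}

/-- `a` is of minimal length in the coset `a · W_J`. -/
def IsMinCosetRep (cs : CoxeterSystem M W) (J : Set B) (a : W) : Prop :=
  ∀ x ∈ Subgroup.closure (cs.simple '' J), cs.length a ≤ cs.length (a * x)

/-- `x = a * b` is the parabolic decomposition of `x` with respect to `J`: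
`b ∈ W_J` and `a` is the minimal length coset representative `x^J`. -/
def IsPDecomp (cs : CoxeterSystem M W) (J : Set B) (x a b : W) : Prop :=
  x = a * b ∧ b ∈ Subgroup.closure (cs.simple '' J) ∧ IsMinCosetRep cs J a

namespace CoxeterSystem

section StrongExchange

theorem end_mul_apply {α : Type*} (f g : Function.End α) (a : α) : (f * g) a = f (g a) := rfl

theorem end_one_apply {α : Type*} (a : α) : (1 : Function.End α) a = a := rfl

open Classical in
/-- The action of a simple reflection on pairs `(t, ε)`: conjugate `t` and flip the sign `ε`
exactly when `t` is the simple reflection. -/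
noncomputable def signedConj (cs : CoxeterSystem M W) (i : B) :
    Function.End (W × ZMod 2) :=
  fun p ↦ (cs.simple i * p.1 * cs.simple i, p.2 + if p.1 = cs.simple i then 1 else 0)

open Classical in
theorem signedConj_mul_pow_apply (cs : CoxeterSystem M W) (i j : B) (n : ℕ) (p : W × ZMod 2) :
    ((cs.signedConj i * cs.signedConj j) ^ n) p =
      ((cs.simple i * cs.simple j) ^ n * p.1 * ((cs.simple i * cs.simple j) ^ n)⁻¹,
        p.2 + ∑ l ∈ Finset.range (2 * n),
          if p.1 = cs.simple j * (cs.simple i * cs.simple j) ^ l then 1 else 0) := by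
  have conj_pow (n : ℕ) : cs.simple j * (cs.simple i * cs.simple j) ^ n * cs.simple j =
      ((cs.simple i * cs.simple j) ^ n)⁻¹ := by
    have h := conj_pow (i := n) (a := cs.simple j) (b := cs.simple i * cs.simple j)
    rw [inv_simple] at h
    rw [← h, ← inv_pow]
    simp [mul_assoc]
  induction n with
  | zero => simp [end_one_apply]
  | succ n ih =>
    rw [pow_succ', end_mul_apply, ih]
    set r := cs.simple i * cs.simple j with hr
    have e₁ : r ^ n * p.1 * (r ^ n)⁻¹ = cs.simple j ↔ p.1 = cs.simple j * r ^ (2 * n) := by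
      rw [mul_inv_eq_iff_eq_mul, ← eq_inv_mul_iff_mul_eq, ← conj_pow n, two_mul, pow_add]
      simp [mul_assoc]
    have e₂ : cs.simple j * (r ^ n * p.1 * (r ^ n)⁻¹) * cs.simple j = cs.simple i ↔
        p.1 = cs.simple j * r ^ (2 * n + 1) := by
      have : cs.simple j * (r ^ n * p.1 * (r ^ n)⁻¹) * cs.simple j = cs.simple i ↔
          r ^ n * p.1 * (r ^ n)⁻¹ = cs.simple j * r := by
        generalize r ^ n * p.1 * (r ^ n)⁻¹ = y
        rw [hr]
        constructor
        · intro h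
          simp [← h, mul_assoc]
        · rintro rfl
          simp [mul_assoc]
      rw [this, mul_inv_eq_iff_eq_mul, ← eq_inv_mul_iff_mul_eq, ← conj_pow n,
        show 2 * n + 1 = n + (1 + n) by ring, pow_add, pow_add, pow_one]
      simp [mul_assoc]
    rw [show 2 * (n + 1) = 2 * n + 1 + 1 by ring, Finset.sum_range_succ, Finset.sum_range_succ,
      end_mul_apply]
    simp only [signedConj, e₁, e₂]
    refine Prod.ext ?_ ?_
    · simp [hr, pow_succ', mul_assoc]
    · simp only
      ring

theorem isLiftable_signedConj (cs : CoxeterSystem M W) : M.IsLiftable cs.signedConj := by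
  classical
  intro i j
  funext p
  rw [signedConj_mul_pow_apply, cs.simple_mul_simple_pow, two_mul, Finset.sum_range_add]
  simp only [pow_add, cs.simple_mul_simple_pow, one_mul, ← two_mul]
  have h2 : (2 : ZMod 2) = 0 := rfl
  simp [h2, end_one_apply]

open Classical in
theorem lift_signedConj_wordProd (cs : CoxeterSystem M W) (ω : List B) (p : W × ZMod 2) :
    cs.lift ⟨cs.signedConj, cs.isLiftable_signedConj⟩ (cs.wordProd ω) p =
      (cs.wordProd ω * p.1 * (cs.wordProd ω)⁻¹, p.2 + (cs.rightInvSeq ω).count p.1) := by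
  induction ω with
  | nil => simp [rightInvSeq, end_one_apply]
  | cons i ω ih =>
    rw [wordProd_cons, map_mul, end_mul_apply, ih,
      lift_apply_simple, signedConj, rightInvSeq, List.count_cons]
    have e : cs.wordProd ω * p.1 * (cs.wordProd ω)⁻¹ = cs.simple i ↔
        (cs.wordProd ω)⁻¹ * cs.simple i * cs.wordProd ω = p.1 := by
      rw [mul_inv_eq_iff_eq_mul, mul_assoc, inv_mul_eq_iff_eq_mul, eq_comm]
    refine Prod.ext ?_ ?_
    · simp [mul_assoc]
    · simp only [e, beq_iff_eq, Nat.cast_add, Nat.cast_ite, Nat.cast_one, Nat.cast_zero]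
      ring

/-- The parity of the number of occurrences of `t` in the right inversion sequence of any word
for `w`. -/
noncomputable def inversionParity (cs : CoxeterSystem M W) (w t : W) : ZMod 2 :=
  (cs.lift ⟨cs.signedConj, cs.isLiftable_signedConj⟩ w (t, 0)).2

open Classical in
theorem inversionParity_wordProd (cs : CoxeterSystem M W) (ω : List B) (t : W) :
    cs.inversionParity (cs.wordProd ω) t = (cs.rightInvSeq ω).count t := by
  simp [inversionParity, lift_signedConj_wordProd]

theorem inversionParity_mul (cs : CoxeterSystem M W) (u v t : W) :
    cs.inversionParity (u * v) t =
      cs.inversionParity v t + cs.inversionParity u (v * t * v⁻¹) := by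
  classical
  obtain ⟨μ, rfl⟩ := cs.wordProd_surjective u
  obtain ⟨ν, rfl⟩ := cs.wordProd_surjective v
  simp [inversionParity, lift_signedConj_wordProd, end_mul_apply]

theorem IsReflection.inversionParity_self {cs : CoxeterSystem M W} {t : W}
    (ht : cs.IsReflection t) : cs.inversionParity t t = 1 := by
  classical
  obtain ⟨u, i, rfl⟩ := ht
  have h_one : cs.inversionParity (u * u⁻¹) (u * cs.simple i * u⁻¹) = 0 := by
    rw [mul_inv_cancel, ← cs.wordProd_nil, inversionParity_wordProd]
    simp [rightInvSeq]
  have h_simple : cs.inversionParity (cs.simple i) (cs.simple i) = 1 := by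
    rw [← cs.wordProd_singleton i, inversionParity_wordProd]
    simp [rightInvSeq]
  have hc : u⁻¹ * (u * cs.simple i * u⁻¹) * u⁻¹⁻¹ = cs.simple i := by group
  rw [inversionParity_mul, hc] at h_one
  rw [inversionParity_mul, hc, inversionParity_mul, h_simple]
  simp only [inv_simple, simple_mul_simple_self, one_mul]
  linear_combination h_one

/-- The strong exchange property. -/
theorem exists_eraseIdx_of_length_lt (cs : CoxeterSystem M W) (ω : List B) {t : W}
    (ht : cs.IsReflection t) (hlt : cs.length (cs.wordProd ω * t) < cs.length (cs.wordProd ω)) :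
    ∃ k < ω.length, cs.wordProd ω * t = cs.wordProd (ω.eraseIdx k) := by
  classical
  suffices hmem : t ∈ cs.rightInvSeq ω by
    obtain ⟨k, hk, rfl⟩ := List.getElem_of_mem hmem
    refine ⟨k, by simpa using hk, ?_⟩
    rw [← cs.wordProd_mul_getD_rightInvSeq, List.getD_eq_getElem _ _ hk]
  by_contra hmem
  have h_zero : cs.inversionParity (cs.wordProd ω) t = 0 := by
    rw [inversionParity_wordProd, List.count_eq_zero_of_not_mem hmem, Nat.cast_zero]
  have h_one : cs.inversionParity (cs.wordProd ω * t) t = 1 := by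
    rw [inversionParity_mul, ht.inversionParity_self, mul_inv_cancel_right, h_zero, add_zero]
  obtain ⟨ν, hν, hνt⟩ := cs.exists_isReduced (cs.wordProd ω * t)
  rw [hνt, inversionParity_wordProd] at h_one
  have : t ∈ cs.rightInvSeq ν := by
    by_contra h
    simp [List.count_eq_zero_of_not_mem h] at h_one
  have := (cs.isRightInversion_of_mem_rightInvSeq hν this).2
  rw [← hνt, mul_assoc, ht.mul_self, mul_one] at this
  lia

theorem exists_eraseIdx_of_isLeftDescent (cs : CoxeterSystem M W) (ω : List B) {i : B}
    (h : cs.IsLeftDescent (cs.wordProd ω) i) :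
    ∃ k < ω.length, cs.simple i * cs.wordProd ω = cs.wordProd (ω.eraseIdx k) := by
  have ht : cs.IsReflection ((cs.wordProd ω)⁻¹ * cs.simple i * cs.wordProd ω) := by
    simpa using (cs.isReflection_simple i).conj (cs.wordProd ω)⁻¹
  have e : cs.wordProd ω * ((cs.wordProd ω)⁻¹ * cs.simple i * cs.wordProd ω) =
      cs.simple i * cs.wordProd ω := by group
  have := cs.exists_eraseIdx_of_length_lt ω ht (by rwa [e])
  rwa [e] at this

end StrongExchange

section Parabolic

theorem exists_isReduced_sublist (cs : CoxeterSystem M W) (ω : List B) :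
    ∃ ν, ν.Sublist ω ∧ cs.IsReduced ν ∧ cs.wordProd ω = cs.wordProd ν := by
  induction ω with
  | nil => exact ⟨[], .slnil, by simp [IsReduced], rfl⟩
  | cons i ω ih =>
    obtain ⟨ν, hsub, hν, heq⟩ := ih
    by_cases h : cs.IsLeftDescent (cs.wordProd ν) i
    · obtain ⟨k, hk, hk'⟩ := cs.exists_eraseIdx_of_isLeftDescent ν h
      refine ⟨ν.eraseIdx k, ((List.eraseIdx_sublist ν k).trans hsub).cons i, ?_, ?_⟩
      · rw [isLeftDescent_iff, hk', hν.eq] at h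
        rw [IsReduced, List.length_eraseIdx_of_lt hk]
        lia
      · rw [wordProd_cons, heq, hk']
    · refine ⟨i :: ν, hsub.cons_cons i, ?_, by rw [wordProd_cons, wordProd_cons, heq]⟩
      rw [not_isLeftDescent_iff, hν.eq] at h
      rw [IsReduced, wordProd_cons, h, List.length_cons]

theorem wordProd_mem_closure (cs : CoxeterSystem M W) {J : Set B} {ω : List B}
    (h : ∀ j ∈ ω, j ∈ J) : cs.wordProd ω ∈ Subgroup.closure (cs.simple '' J) := by
  refine Subgroup.list_prod_mem _ fun x hx ↦ ?_
  obtain ⟨j, hj, rfl⟩ := List.mem_map.mp hx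
  exact Subgroup.subset_closure ⟨j, h j hj, rfl⟩

theorem exists_isReduced_of_mem_closure (cs : CoxeterSystem M W) {J : Set B} {x : W}
    (hx : x ∈ Subgroup.closure (cs.simple '' J)) :
    ∃ ω, cs.IsReduced ω ∧ x = cs.wordProd ω ∧ ∀ j ∈ ω, j ∈ J := by
  suffices h : ∃ ω : List B, x = cs.wordProd ω ∧ ∀ j ∈ ω, j ∈ J by
    obtain ⟨ω, rfl, hω⟩ := h
    obtain ⟨ν, hsub, hν, heq⟩ := cs.exists_isReduced_sublist ω
    exact ⟨ν, hν, heq, fun j hj ↦ hω j (hsub.subset hj)⟩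
  induction hx using Subgroup.closure_induction with
  | mem x hx =>
    obtain ⟨j, hj, rfl⟩ := hx
    exact ⟨[j], by simp, by simpa using hj⟩
  | one => exact ⟨[], by simp, by simp⟩
  | mul x y _ _ hx hy =>
    obtain ⟨μ, rfl, hμ⟩ := hx
    obtain ⟨ν, rfl, hν⟩ := hy
    refine ⟨μ ++ ν, by rw [wordProd_append], fun j hj ↦ ?_⟩
    exact (List.mem_append.mp hj).elim (hμ j) (hν j)
  | inv x _ hx =>
    obtain ⟨μ, rfl, hμ⟩ := hx
    exact ⟨μ.reverse, by simp, by simpa using hμ⟩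

theorem IsReduced.isLeftDescent_cons {cs : CoxeterSystem M W} {i : B} {ω : List B}
    (h : cs.IsReduced (i :: ω)) : cs.IsLeftDescent (cs.wordProd (i :: ω)) i := by
  rw [IsLeftDescent, h.eq, wordProd_cons, simple_mul_simple_cancel_left, List.length_cons]
  exact Nat.lt_succ_of_le (cs.length_wordProd_le ω)

theorem IsReduced.simple_mem_closure {cs : CoxeterSystem M W} {J : Set B} {ω : List B}
    (hω : cs.IsReduced ω) (hmem : cs.wordProd ω ∈ Subgroup.closure (cs.simple '' J)) :
    ∀ j ∈ ω, cs.simple j ∈ Subgroup.closure (cs.simple '' J) := by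
  induction ω with
  | nil => simp
  | cons i ω ih =>
    obtain ⟨ν, hν, heq, hJ⟩ := cs.exists_isReduced_of_mem_closure hmem
    have hd := hω.isLeftDescent_cons
    rw [heq] at hd
    obtain ⟨k, hk, hk'⟩ := cs.exists_eraseIdx_of_isLeftDescent ν hd
    rw [← heq, wordProd_cons, simple_mul_simple_cancel_left] at hk'
    have hmem' : cs.wordProd ω ∈ Subgroup.closure (cs.simple '' J) := by
      rw [hk']
      exact cs.wordProd_mem_closure fun j hj ↦ hJ j ((List.eraseIdx_sublist ν k).subset hj)
    intro j hj
    rcases List.mem_cons.mp hj with rfl | hj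
    · rw [wordProd_cons] at hmem
      exact (Subgroup.mul_mem_cancel_right _ hmem').mp hmem
    · exact ih (by simpa using hω.drop 1) hmem' j hj

theorem exists_simple_eq_of_mem_closure (cs : CoxeterSystem M W) {J : Set B} {j : B}
    (h : cs.simple j ∈ Subgroup.closure (cs.simple '' J)) :
    ∃ k ∈ J, cs.simple j = cs.simple k := by
  obtain ⟨ω, hω, heq, hJ⟩ := cs.exists_isReduced_of_mem_closure h
  have hlen := hω.eq
  rw [← heq, length_simple] at hlen
  obtain ⟨k, rfl⟩ := List.length_eq_one_iff.mp hlen.symm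
  exact ⟨k, hJ k (by simp), by simpa using heq⟩

theorem mem_supp_of_simple_eq (cs : CoxeterSystem M W) {x : W} {j k : B}
    (hj : j ∈ supp cs x) (h : cs.simple j = cs.simple k) : k ∈ supp cs x := by
  obtain ⟨ω, hω, rfl, hmem⟩ := hj
  obtain ⟨l₁, l₂, rfl⟩ := List.append_of_mem hmem
  have e : cs.wordProd (l₁ ++ j :: l₂) = cs.wordProd (l₁ ++ k :: l₂) := by
    simp only [wordProd_append, wordProd_cons, h]
  refine ⟨l₁ ++ k :: l₂, ?_, e, by simp⟩
  rw [IsReduced, ← e, hω.eq]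
  simp

theorem IsLeftDescent.mem_supp {cs : CoxeterSystem M W} {x : W} {j : B}
    (h : cs.IsLeftDescent x j) : j ∈ supp cs x := by
  obtain ⟨ω, hω, heq⟩ := cs.exists_isReduced (cs.simple j * x)
  have hx : x = cs.wordProd (j :: ω) := by
    rw [wordProd_cons, ← heq, simple_mul_simple_cancel_left]
  refine ⟨j :: ω, ?_, hx, by simp⟩
  rw [isLeftDescent_iff, heq, hω.eq] at h
  rw [IsReduced, ← hx, ← h, List.length_cons]

theorem isReduced_append_of_isMinCosetRep (cs : CoxeterSystem M W) {J : Set B} {α β : List B}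
    (hα : cs.IsReduced α) (hmin : IsMinCosetRep cs J (cs.wordProd α)) (hβ : cs.IsReduced β)
    (hJ : ∀ j ∈ β, j ∈ J) : cs.IsReduced (α ++ β) := by
  induction β using List.reverseRecOn with
  | nil => simpa using hα
  | append_singleton β j ih =>
    have hβ' : cs.IsReduced β := by simpa using hβ.take β.length
    have hJ' : ∀ k ∈ β, k ∈ J := fun k hk ↦ hJ k (by simp [hk])
    have hαβ := ih hβ' hJ'
    have e : cs.wordProd (α ++ (β ++ [j])) = cs.wordProd (α ++ β) * cs.simple j := by
      simp [wordProd_append, mul_assoc]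
    rcases cs.length_mul_simple (cs.wordProd (α ++ β)) j with h | h
    · rw [IsReduced, e, h, hαβ.eq]
      simp [add_assoc]
    exfalso
    obtain ⟨k, hk, hk'⟩ := cs.exists_eraseIdx_of_length_lt (α ++ β) (cs.isReflection_simple j)
      (by lia)
    rcases lt_or_ge k α.length with hkα | hkα
    · rw [List.eraseIdx_append_of_lt_length hkα, wordProd_append, wordProd_append] at hk'
      have hx : cs.wordProd α * (cs.wordProd β * cs.simple j * (cs.wordProd β)⁻¹) =
          cs.wordProd (α.eraseIdx k) := by
        rw [← mul_assoc, ← mul_assoc, hk', mul_inv_cancel_right]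
      have hβm := cs.wordProd_mem_closure hJ'
      have hjm : cs.simple j ∈ Subgroup.closure (cs.simple '' J) :=
        Subgroup.subset_closure ⟨j, hJ j (by simp), rfl⟩
      have h_le := hmin _ (mul_mem (mul_mem hβm hjm) (inv_mem hβm))
      have h_le' := cs.length_wordProd_le (α.eraseIdx k)
      rw [hx, hα.eq] at h_le
      rw [List.length_eraseIdx_of_lt hkα] at h_le'
      lia
    · rw [List.eraseIdx_append_of_length_le hkα, wordProd_append, wordProd_append, mul_assoc,
        mul_right_inj] at hk'
      have h_le := cs.length_wordProd_le (β.eraseIdx (k - α.length))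
      rw [← hk', ← wordProd_singleton, ← wordProd_append, hβ.eq] at h_le
      have := (List.eraseIdx_sublist β (k - α.length)).length_le
      simp at h_le
      lia

theorem exists_isPDecomp (cs : CoxeterSystem M W) (J : Set B) (x : W) :
    ∃ u p, IsPDecomp cs J x u p := by
  let S : Set W := {u | u⁻¹ * x ∈ Subgroup.closure (cs.simple '' J)}
  have hS : S.Nonempty := ⟨x, by simp [S]⟩
  let u := Function.argminOn cs.length S hS
  have hu : u ∈ S := Function.argminOn_mem cs.length S hS
  refine ⟨u, u⁻¹ * x, by group, hu, fun c hc ↦ ?_⟩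
  refine Function.argminOn_le cs.length S (a := u * c) ?_
  change (u * c)⁻¹ * x ∈ Subgroup.closure (cs.simple '' J)
  rw [mul_inv_rev, mul_assoc]
  exact mul_mem (inv_mem hc) hu

theorem length_mul_of_isMinCosetRep (cs : CoxeterSystem M W) {J : Set B} {u p : W}
    (hu : IsMinCosetRep cs J u) (hp : p ∈ Subgroup.closure (cs.simple '' J)) :
    cs.length (u * p) = cs.length u + cs.length p := by
  obtain ⟨α, hα, rfl⟩ := cs.exists_isReduced u
  obtain ⟨β, hβ, rfl, hJ⟩ := cs.exists_isReduced_of_mem_closure hp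
  have := cs.isReduced_append_of_isMinCosetRep hα hu hβ hJ
  rw [← wordProd_append, this.eq, hα.eq, hβ.eq, List.length_append]

theorem isPDecomp_unique (cs : CoxeterSystem M W) {J : Set B} {x u p v q : W}
    (h : IsPDecomp cs J x u p) (h' : IsPDecomp cs J x v q) : u = v ∧ p = q := by
  obtain ⟨rfl, hp, hu⟩ := h
  obtain ⟨heq, hq, hv⟩ := h'
  have hc : p * q⁻¹ ∈ Subgroup.closure (cs.simple '' J) := mul_mem hp (inv_mem hq)
  have hvc : v = u * (p * q⁻¹) := by rw [← mul_assoc, heq, mul_inv_cancel_right]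
  have h_len := cs.length_mul_of_isMinCosetRep hu hc
  have h_le := hv _ (inv_mem hc)
  rw [hvc, mul_inv_cancel_right, h_len] at h_le
  have h_one : p * q⁻¹ = 1 := cs.length_eq_zero_iff.mp (by lia)
  exact ⟨by rw [hvc, h_one, mul_one], mul_inv_eq_one.mp h_one⟩

end Parabolic

section Bruhat

theorem bruhatLE_simple_mul (cs : CoxeterSystem M W) {x : W} {i : B}
    (h : cs.length x < cs.length (cs.simple i * x)) : bruhatLE cs x (cs.simple i * x) := by
  refine .single ⟨x⁻¹ * cs.simple i * x, ?_, by group, h⟩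
  simpa using (cs.isReflection_simple i).conj x⁻¹

theorem exists_sublist_of_bruhatLE (cs : CoxeterSystem M W) {x : W} {ω : List B}
    (h : bruhatLE cs x (cs.wordProd ω)) : ∃ ν, ν.Sublist ω ∧ x = cs.wordProd ν := by
  induction h using Relation.ReflTransGen.head_induction_on with
  | refl => exact ⟨ω, .refl ω, rfl⟩
  | head hstep _ ih =>
    obtain ⟨ν, hsub, rfl⟩ := ih
    obtain ⟨t, ht, heq, hlt⟩ := hstep
    have hx := eq_mul_inv_of_mul_eq heq.symm
    rw [ht.inv] at hx
    rw [hx] at hlt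
    obtain ⟨k, -, hk⟩ := cs.exists_eraseIdx_of_length_lt ν ht hlt
    exact ⟨ν.eraseIdx k, (List.eraseIdx_sublist ν k).trans hsub, hx.trans hk⟩

theorem bruhatStep_simple_mul (cs : CoxeterSystem M W) {x y : W} (h : bruhatStep cs x y)
    (i : B) : cs.simple i * x = y ∨ bruhatStep cs (cs.simple i * x) (cs.simple i * y) := by
  obtain ⟨t, ht, rfl, hlt⟩ := h
  by_cases hlt' : cs.length (cs.simple i * x) < cs.length (cs.simple i * (x * t))
  · exact .inr ⟨t, ht, by rw [mul_assoc], hlt'⟩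
  left
  have hne := ht.length_mul_left_ne (cs.simple i * x)
  rw [mul_assoc] at hne
  obtain ⟨ω, hω, heq⟩ := cs.exists_isReduced (cs.simple i * (x * t))
  have hy : x * t = cs.wordProd (i :: ω) := by
    rw [wordProd_cons, ← heq, simple_mul_simple_cancel_left]
  have hx : cs.wordProd (i :: ω) * t = x := by rw [← hy, mul_assoc, ht.mul_self, mul_one]
  obtain ⟨k, hk, hk'⟩ := cs.exists_eraseIdx_of_length_lt (i :: ω) ht (by rwa [hx, ← hy])
  rw [hx] at hk'
  cases k with
  | zero =>
    rw [hy, wordProd_cons, hk', List.eraseIdx_cons_zero]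
  | succ k =>
    exfalso
    rw [List.eraseIdx_cons_succ, wordProd_cons] at hk'
    have h_len : cs.length (cs.simple i * x) ≤ (ω.eraseIdx k).length := by
      rw [hk', simple_mul_simple_cancel_left]
      exact cs.length_wordProd_le _
    have := (List.eraseIdx_sublist ω k).length_le
    rw [heq, hω.eq] at hlt' hne
    lia

theorem bruhatLE_simple_mul_or (cs : CoxeterSystem M W) {x y : W} (h : bruhatLE cs x y) (i : B) :
    bruhatLE cs (cs.simple i * x) y ∨ bruhatLE cs (cs.simple i * x) (cs.simple i * y) := by
  induction h with
  | refl => exact .inr .refl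
  | tail _ hstep ih =>
    rcases ih with ih | ih
    · exact .inl (ih.tail hstep)
    · rcases cs.bruhatStep_simple_mul hstep i with h | h
      · exact .inl (h ▸ ih)
      · exact .inr (ih.tail h)

theorem IsLeftDescent.bruhatLE_simple_mul_left {cs : CoxeterSystem M W} {x y : W} {i : B}
    (hi : cs.IsLeftDescent y i) (h : bruhatLE cs x y) : bruhatLE cs (cs.simple i * x) y := by
  rcases cs.bruhatLE_simple_mul_or h i with h' | h'
  · exact h'
  · refine h'.trans ?_
    have := cs.bruhatLE_simple_mul (x := cs.simple i * y) (i := i)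
    rw [simple_mul_simple_cancel_left] at this
    exact this hi

theorem IsReduced.bruhatLE_of_sublist {cs : CoxeterSystem M W} {ω ν : List B}
    (hω : cs.IsReduced ω) (h : ν.Sublist ω) : bruhatLE cs (cs.wordProd ν) (cs.wordProd ω) := by
  induction h with
  | slnil => exact .refl
  | @cons ν ω i _ ih =>
    have hd := hω.isLeftDescent_cons
    rw [IsLeftDescent, wordProd_cons, simple_mul_simple_cancel_left] at hd
    rw [wordProd_cons]
    exact (ih (by simpa using hω.drop 1)).trans (cs.bruhatLE_simple_mul hd)
  | @cons_cons ν ω i _ ih =>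
    have hd := hω.isLeftDescent_cons
    rw [IsLeftDescent, wordProd_cons, simple_mul_simple_cancel_left] at hd
    rw [wordProd_cons, wordProd_cons]
    rcases cs.bruhatLE_simple_mul_or (ih (by simpa using hω.drop 1)) i with h | h
    · exact h.trans (cs.bruhatLE_simple_mul hd)
    · exact h

theorem one_bruhatLE (cs : CoxeterSystem M W) (x : W) : bruhatLE cs 1 x := by
  obtain ⟨ω, hω, rfl⟩ := cs.exists_isReduced x
  simpa using hω.bruhatLE_of_sublist (List.nil_sublist ω)

theorem bruhatLE_mul (cs : CoxeterSystem M W) {a b u p : W}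
    (hab : cs.length (a * b) = cs.length a + cs.length b)
    (hu : bruhatLE cs u a) (hp : bruhatLE cs p b) : bruhatLE cs (u * p) (a * b) := by
  obtain ⟨α, hα, rfl⟩ := cs.exists_isReduced a
  obtain ⟨β, hβ, rfl⟩ := cs.exists_isReduced b
  obtain ⟨μ, hμ, rfl⟩ := cs.exists_sublist_of_bruhatLE hu
  obtain ⟨ν, hν, rfl⟩ := cs.exists_sublist_of_bruhatLE hp
  rw [← wordProd_append, ← wordProd_append]
  refine IsReduced.bruhatLE_of_sublist ?_ (hμ.append hν)
  rw [IsReduced, wordProd_append, hab, hα.eq, hβ.eq, List.length_append]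

theorem exists_mul_of_bruhatLE_mul (cs : CoxeterSystem M W) {a b x : W}
    (h : bruhatLE cs x (a * b)) : ∃ u p, x = u * p ∧ bruhatLE cs u a ∧ bruhatLE cs p b := by
  obtain ⟨α, hα, rfl⟩ := cs.exists_isReduced a
  obtain ⟨β, hβ, rfl⟩ := cs.exists_isReduced b
  rw [← wordProd_append] at h
  obtain ⟨ν, hν, rfl⟩ := cs.exists_sublist_of_bruhatLE h
  obtain ⟨ν₁, ν₂, rfl, h₁, h₂⟩ := List.sublist_append_iff.mp hν
  exact ⟨_, _, wordProd_append .., hα.bruhatLE_of_sublist h₁, hβ.bruhatLE_of_sublist h₂⟩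

theorem bruhatLE.mem_closure_supp {cs : CoxeterSystem M W} {u a : W} (h : bruhatLE cs u a) :
    u ∈ Subgroup.closure (cs.simple '' supp cs a) := by
  obtain ⟨α, hα, rfl⟩ := cs.exists_isReduced a
  obtain ⟨μ, hμ, rfl⟩ := cs.exists_sublist_of_bruhatLE h
  exact cs.wordProd_mem_closure fun j hj ↦ ⟨α, hα, rfl, hμ.subset hj⟩

theorem bruhatLE_mul_of_isMinCosetRep (cs : CoxeterSystem M W) {J : Set B} {u p : W}
    (hu : IsMinCosetRep cs J u) (hp : p ∈ Subgroup.closure (cs.simple '' J)) :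
    bruhatLE cs u (u * p) := by
  simpa using cs.bruhatLE_mul (cs.length_mul_of_isMinCosetRep hu hp) .refl (cs.one_bruhatLE p)

/-- If a product of elements of two standard parabolic subgroups is a reflection, then one of the
factors lies in their intersection. -/
theorem IsReflection.mem_closure_or_mem_closure_of_mul {cs : CoxeterSystem M W} {I J : Set B}
    {g h : W} (hgh : cs.IsReflection (g * h)) (hg : g ∈ Subgroup.closure (cs.simple '' I))
    (hh : h ∈ Subgroup.closure (cs.simple '' J)) :
    g ∈ Subgroup.closure (cs.simple '' J) ∨ h ∈ Subgroup.closure (cs.simple '' I) := by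
  have key {K : Set B} {x t : W} (ht : cs.IsReflection t)
      (hx : x ∈ Subgroup.closure (cs.simple '' K)) (hlt : cs.length (x * t) < cs.length x) :
      x * t ∈ Subgroup.closure (cs.simple '' K) := by
    obtain ⟨ω, hω, rfl, hK⟩ := cs.exists_isReduced_of_mem_closure hx
    obtain ⟨k, -, hk⟩ := cs.exists_eraseIdx_of_length_lt ω ht hlt
    rw [hk]
    exact cs.wordProd_mem_closure fun j hj ↦ hK j ((List.eraseIdx_sublist ω k).subset hj)
  have e : h * (g * h) = g⁻¹ := by
    rw [← hgh.inv]
    group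
  have e' : g⁻¹ * (g * h) = h := by group
  have hne := hgh.length_mul_left_ne h
  rw [e] at hne
  rcases hne.lt_or_gt with hlt | hlt
  · left
    have := key hgh hh (by rwa [e])
    rw [e] at this
    exact inv_mem_iff.mp this
  · right
    have := key hgh (inv_mem hg) (by rwa [e'])
    rwa [e'] at this

end Bruhat

section BilleyPostnikov

/-- The parabolic subgroups attached to `supp w^J` and `J` meet in the subgroup generated by the
shared simple reflection. -/
theorem eq_one_or_eq_simple_of_mem_closure (cs : CoxeterSystem M W) {J : Set B} {a b : W} {i : B}
    (hBP : supp cs a ∩ J ⊆ {j | cs.IsLeftDescent b j}) (hsupp : supp cs a ∩ supp cs b = {i})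
    {x : W} (hxa : x ∈ Subgroup.closure (cs.simple '' supp cs a))
    (hxJ : x ∈ Subgroup.closure (cs.simple '' J)) : x = 1 ∨ x = cs.simple i := by
  obtain ⟨ω, hω, rfl⟩ := cs.exists_isReduced x
  have hall : ∀ j ∈ ω, cs.simple j = cs.simple i := by
    intro j hj
    obtain ⟨k, hk, hjk⟩ := cs.exists_simple_eq_of_mem_closure (hω.simple_mem_closure hxa j hj)
    obtain ⟨l, hl, hjl⟩ := cs.exists_simple_eq_of_mem_closure (hω.simple_mem_closure hxJ j hj)
    have hla : l ∈ supp cs a := cs.mem_supp_of_simple_eq hk (hjk.symm.trans hjl)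
    have hlb : l ∈ supp cs b := IsLeftDescent.mem_supp (hBP ⟨hla, hl⟩)
    have hli : l = i := by
      have : l ∈ supp cs a ∩ supp cs b := ⟨hla, hlb⟩
      rwa [hsupp] at this
    rw [hjl, hli]
  clear hω hxa hxJ
  induction ω with
  | nil => simp
  | cons j ω ih =>
    rw [wordProd_cons, hall j (by simp)]
    rcases ih fun k hk ↦ hall k (by simp [hk]) with h | h <;> simp [h]

theorem isLeftDescent_of_supp_inter_supp (cs : CoxeterSystem M W) {J : Set B} {a b : W} {i : B}
    (hb : b ∈ Subgroup.closure (cs.simple '' J))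
    (hBP : supp cs a ∩ J ⊆ {j | cs.IsLeftDescent b j}) (hsupp : supp cs a ∩ supp cs b = {i}) :
    i ∈ J ∧ cs.IsLeftDescent b i := by
  have hi : i ∈ supp cs a ∩ supp cs b := hsupp ▸ rfl
  obtain ⟨hia, ω, hω, heq, hiω⟩ := hi
  obtain ⟨k, hk, hik⟩ := cs.exists_simple_eq_of_mem_closure
    (hω.simple_mem_closure (heq ▸ hb) i hiω)
  have hki : k ∈ supp cs a ∩ supp cs b :=
    ⟨cs.mem_supp_of_simple_eq hia hik, cs.mem_supp_of_simple_eq ⟨ω, hω, heq, hiω⟩ hik⟩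
  rw [hsupp] at hki
  obtain rfl : k = i := hki
  exact ⟨hk, hBP ⟨hia, hk⟩⟩

theorem bruhatLE_iff_of_isPDecomp (cs : CoxeterSystem M W) {J : Set B} {w a b x u p : W} {i : B}
    (hdec : IsPDecomp cs J w a b) (hBP : supp cs a ∩ J ⊆ {j | cs.IsLeftDescent b j})
    (hsupp : supp cs a ∩ supp cs b = {i}) (hx : IsPDecomp cs J x u p) :
    bruhatLE cs x w ↔ bruhatLE cs u a ∧ bruhatLE cs p b := by
  obtain ⟨rfl, hb, ha⟩ := hdec
  refine ⟨fun hle ↦ ?_, fun ⟨hu, hp⟩ ↦ ?_⟩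
  · obtain ⟨y, q, rfl, hy, hq⟩ := cs.exists_mul_of_bruhatLE_mul hle
    obtain ⟨v, c, rfl, hc, hv⟩ := cs.exists_isPDecomp J y
    obtain ⟨β, hβ, rfl, hβJ⟩ := cs.exists_isReduced_of_mem_closure hb
    have hqJ : q ∈ Subgroup.closure (cs.simple '' J) := by
      obtain ⟨ν, hν, rfl⟩ := cs.exists_sublist_of_bruhatLE hq
      exact cs.wordProd_mem_closure fun j hj ↦ hβJ j (hν.subset hj)
    obtain ⟨rfl, rfl⟩ := cs.isPDecomp_unique hx ⟨mul_assoc v c q, mul_mem hc hqJ, hv⟩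
    have hva := (cs.bruhatLE_mul_of_isMinCosetRep hv hc).trans hy
    have hc' : c ∈ Subgroup.closure (cs.simple '' supp cs a) :=
      (Subgroup.mul_mem_cancel_left _ (bruhatLE.mem_closure_supp hva)).mp
        (bruhatLE.mem_closure_supp hy)
    refine ⟨hva, ?_⟩
    rcases cs.eq_one_or_eq_simple_of_mem_closure hBP hsupp hc' hc with rfl | rfl
    · simpa using hq
    · exact (cs.isLeftDescent_of_supp_inter_supp hb hBP hsupp).2.bruhatLE_simple_mul_left hq
  · rw [hx.1]
    exact cs.bruhatLE_mul (cs.length_mul_of_isMinCosetRep ha hb) hu hp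

/-- Multiplying by the shared simple reflection between the factors preserves reflections. -/
theorem IsReflection.middle_mul {cs : CoxeterSystem M W} {J : Set B} {a b u v p q : W} {i : B}
    (hBP : supp cs a ∩ J ⊆ {j | cs.IsLeftDescent b j}) (hsupp : supp cs a ∩ supp cs b = {i})
    (hu : bruhatLE cs u a) (hv : bruhatLE cs v a)
    (hp : p ∈ Subgroup.closure (cs.simple '' J)) (hq : q ∈ Subgroup.closure (cs.simple '' J))
    (h : cs.IsReflection ((u * p)⁻¹ * (v * q))) :
    cs.IsReflection ((u * cs.simple i * p)⁻¹ * (v * cs.simple i * q)) := by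
  have hg := mul_mem (inv_mem (bruhatLE.mem_closure_supp hu)) (bruhatLE.mem_closure_supp hv)
  have hh := mul_mem hq (inv_mem hp)
  have hgh : cs.IsReflection (u⁻¹ * v * (q * p⁻¹)) := by
    convert h.conj p using 1
    group
  have e : (u * cs.simple i * p)⁻¹ * (v * cs.simple i * q) =
      p⁻¹ * (cs.simple i * (u⁻¹ * v) * cs.simple i * (q * p⁻¹)) * p⁻¹⁻¹ := by
    simp [mul_assoc]
  rw [e, isReflection_conj_iff]
  rcases hgh.mem_closure_or_mem_closure_of_mul hg hh with hg' | hh'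
  · rcases cs.eq_one_or_eq_simple_of_mem_closure hBP hsupp hg hg' with h₁ | h₁ <;>
      rw [h₁] at hgh ⊢ <;> simpa using hgh
  · have hconj := hgh.conj (cs.simple i)
    rcases cs.eq_one_or_eq_simple_of_mem_closure hBP hsupp hh' hh with h₁ | h₁ <;>
      rw [h₁] at hconj ⊢ <;> simpa [mul_assoc] using hconj

end BilleyPostnikov

end CoxeterSystem

/-- If `w = w^J · w_J` is a BP-decomposition with `supp(w^J) ∩ supp(w_J) = {s}`, then middle
multiplication `x ↦ x^J · s · x_J` is an automorphism of the undirected Bruhat graph on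
`[e,w]`. -/
theorem stmt16 (cs : CoxeterSystem M W) (J : Set B) (w a b : W) (i : B)
    (hdec : IsPDecomp cs J w a b)
    (hBP : supp cs a ∩ J ⊆ {j | cs.IsLeftDescent b j})
    (hsupp : supp cs a ∩ supp cs b = {i}) :
    ∃ φ : W → W,
      (∀ x a' b' : W, IsPDecomp cs J x a' b' → φ x = a' * cs.simple i * b') ∧
      Set.BijOn φ (bruhatInterval cs 1 w) (bruhatInterval cs 1 w) ∧
      ∀ x ∈ bruhatInterval cs 1 w, ∀ y ∈ bruhatInterval cs 1 w,
        (cs.IsReflection (x⁻¹ * y) ↔ cs.IsReflection ((φ x)⁻¹ * φ y)) := by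
  obtain ⟨hiJ, hib⟩ := cs.isLeftDescent_of_supp_inter_supp hdec.2.1 hBP hsupp
  have hs : cs.simple i ∈ Subgroup.closure (cs.simple '' J) :=
    Subgroup.subset_closure ⟨i, hiJ, rfl⟩
  choose U P hUP using cs.exists_isPDecomp J
  let φ : W → W := fun x ↦ U x * cs.simple i * P x
  have hφ (x u p : W) (h : IsPDecomp cs J x u p) : φ x = u * cs.simple i * p := by
    obtain ⟨rfl, rfl⟩ := cs.isPDecomp_unique h (hUP x)
    rfl
  have hφdec (x : W) : IsPDecomp cs J (φ x) (U x) (cs.simple i * P x) :=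
    ⟨mul_assoc .., mul_mem hs (hUP x).2.1, (hUP x).2.2⟩
  have hinv (x : W) : φ (φ x) = x := by
    rw [hφ _ _ _ (hφdec x)]
    simpa [mul_assoc] using (hUP x).1.symm
  have hle (x : W) (hx : x ∈ bruhatInterval cs 1 w) :
      bruhatLE cs (U x) a ∧ bruhatLE cs (P x) b :=
    (cs.bruhatLE_iff_of_isPDecomp hdec hBP hsupp (hUP x)).mp hx.2
  have hmaps : Set.MapsTo φ (bruhatInterval cs 1 w) (bruhatInterval cs 1 w) := fun x hx ↦
    ⟨cs.one_bruhatLE _, (cs.bruhatLE_iff_of_isPDecomp hdec hBP hsupp (hφdec x)).mpr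
      ⟨(hle x hx).1, hib.bruhatLE_simple_mul_left (hle x hx).2⟩⟩
  have hrefl (x y : W) (hx : x ∈ bruhatInterval cs 1 w) (hy : y ∈ bruhatInterval cs 1 w)
      (h : cs.IsReflection (x⁻¹ * y)) : cs.IsReflection ((φ x)⁻¹ * φ y) := by
    refine IsReflection.middle_mul hBP hsupp (hle x hx).1 (hle y hy).1
      (hUP x).2.1 (hUP y).2.1 ?_
    rwa [← (hUP x).1, ← (hUP y).1]
  refine ⟨φ, hφ, ⟨hmaps, (Function.LeftInverse.injective hinv).injOn,
    fun x hx ↦ ⟨φ x, hmaps hx, hinv x⟩⟩, fun x hx y hy ↦ ⟨hrefl x y hx hy, fun h ↦ ?_⟩⟩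
  have := hrefl _ _ (hmaps hx) (hmaps hy) h
  rwa [hinv, hinv] at this
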